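/- arXiv:2401.10183 — 2 statements merged into one kernel-verified Lean document; each statement's English description precedes it below -/
import Mathlib

section
/- Assume V is simple as a K[G]-module and admits an invariant lattice Λ₀. Let W_i and W_j be simple F[G]-modules, each occurring with multiplicity one in Λ₀/πΛ₀ (i.e., some composition series of Λ₀/πΛ₀ has exactly one factor isomorphic to W_i and exactly one factor isomorphic to W_j). Suppose Λ and Λ' are invariant lattices with F[G]-submodules V₁ ⊆ V₂ ⊆ V₃ of Λ/πΛ and V₁' ⊆ V₂' ⊆ V₃' of Λ'/πΛ' such that V₂/V₁ ≅ W_j, V₃/V₂ ≅ W_i, V₂'/V₁' ≅ W_j, V₃'/V₂' ≅ W_i, and neither of the short exact sequences 0 → V₂/V₁ → V₃/V₁ → V₃/V₂ → 0 and 0 → V₂'/V₁' → V₃'/V₁' → V₃'/V₂' → 0 splits. Then V₃/V₁ and V₃'/V₁' are isomorphic as F[G]-modules. -/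
noncomputable section

attribute [local instance] Classical.propDecidable

open Pointwise

/-! ### Generic machinery: modules equipped with a family of endomorphisms
indexed by a group `G` (i.e. "`R[G]`-modules"). -/

section Generic

variable {R : Type*} [CommRing R] {M : Type*} [AddCommGroup M] [Module R M]
variable {G : Type*}

/-- A submodule stable under all the endomorphisms `σ g`. -/
def ActStable (σ : G → M →ₗ[R] M) (W : Submodule R M) : Prop :=
  ∀ g : G, ∀ x ∈ W, σ g x ∈ W

/-- The subquotient `W₂ / W₁`. -/
abbrev SubQuot (W₁ W₂ : Submodule R M) : Type _ :=
  W₂ ⧸ (W₁.comap W₂.subtype)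

/-- The endomorphism of `W₂/W₁` induced by `σ g` (junk value `0` if `σ g` does not
preserve `W₁` and `W₂`). -/
noncomputable def subQuotMap (σ : G → M →ₗ[R] M) (W₁ W₂ : Submodule R M) (g : G) :
    SubQuot W₁ W₂ →ₗ[R] SubQuot W₁ W₂ :=
  if h : (∀ x ∈ W₂, σ g x ∈ W₂) ∧ ∀ x ∈ W₂, x ∈ W₁ → σ g x ∈ W₁ then
    Submodule.mapQ _ _ ((σ g).restrict (p := W₂) (q := W₂) h.1)
      (by intro x hx; exact h.2 x x.2 hx)
  else 0

/-- The endomorphism of a stable submodule `W` induced by `σ g`. -/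
noncomputable def subAct (σ : G → M →ₗ[R] M) (W : Submodule R M) (g : G) : W →ₗ[R] W :=
  if h : ∀ x ∈ W, σ g x ∈ W then (σ g).restrict h else 0

/-- The endomorphism of `M ⧸ W` induced by `σ g`. -/
noncomputable def quotMap (σ : G → M →ₗ[R] M) (W : Submodule R M) (g : G) :
    (M ⧸ W) →ₗ[R] (M ⧸ W) :=
  if h : W ≤ W.comap (σ g) then Submodule.mapQ W W (σ g) h else 0

/-- Two modules-with-`G`-action are isomorphic: there is a linear equivalence
commuting with the two actions. -/
def IsRepIso {N : Type*} [AddCommGroup N] [Module R N]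
    (σ : G → M →ₗ[R] M) (τ : G → N →ₗ[R] N) : Prop :=
  ∃ e : M ≃ₗ[R] N, ∀ (g : G) (x : M), e (σ g x) = τ g (e x)

/-- `M` with the action `σ` is a simple module-with-action. -/
def IsSimpleAct (σ : G → M →ₗ[R] M) : Prop :=
  Nontrivial M ∧ ∀ W : Submodule R M, ActStable σ W → W = ⊥ ∨ W = ⊤

/-- `W` is a simple stable submodule of `M`. -/
def IsSimpleSubmodule (σ : G → M →ₗ[R] M) (W : Submodule R M) : Prop :=
  ActStable σ W ∧ W ≠ ⊥ ∧ ∀ U : Submodule R M, ActStable σ U → U ≤ W → U = ⊥ ∨ U = W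

/-- The socle: the sum of all simple stable submodules. -/
def actSocle (σ : G → M →ₗ[R] M) : Submodule R M :=
  sSup {W | IsSimpleSubmodule σ W}

/-- The socle filtration: `socFilt σ 0 = ⊥` and `socFilt σ (k+1)` is the preimage in `M`
of the socle of `M / socFilt σ k`. -/
noncomputable def socFilt (σ : G → M →ₗ[R] M) : ℕ → Submodule R M
  | 0 => ⊥
  | k + 1 => (actSocle (quotMap σ (socFilt σ k))).comap (socFilt σ k).mkQ

/-- `(A₁, A₂)` is a sharp subquotient: every stable submodule strictly containing `A₁`
contains `A₂`. -/
def IsSharp (σ : G → M →ₗ[R] M) (A₁ A₂ : Submodule R M) : Prop :=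
  ActStable σ A₁ ∧ ActStable σ A₂ ∧ A₁ < A₂ ∧
    ∀ W : Submodule R M, ActStable σ W → A₁ < W → A₂ ≤ W

/-- `(A₁, A₂)` is an irreducible subquotient: `A₂/A₁` is simple, i.e. there is no stable
submodule strictly between `A₁` and `A₂`. -/
def IsIrredSubquot (σ : G → M →ₗ[R] M) (A₁ A₂ : Submodule R M) : Prop :=
  ActStable σ A₁ ∧ ActStable σ A₂ ∧ A₁ < A₂ ∧
    ∀ W : Submodule R M, ActStable σ W → A₁ ≤ W → W ≤ A₂ → W = A₁ ∨ W = A₂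

end Generic

/-! ### Lattices in representations over a discretely valued field -/

section LatticeDefs

variable {O : Type*} [CommRing O]
variable {V : Type*} [AddCommGroup V] [Module O V]

/-- A lattice: a finitely generated `O`-submodule of `V` spanning `V` over `K`. -/
def IsLattice (K : Type*) [Field K] [Module K V] (Λ : Submodule O V) : Prop :=
  Λ.FG ∧ Submodule.span K (Λ : Set V) = ⊤

/-- Two lattices are homothetic: `Λ' = λ • Λ` for some nonzero `λ ∈ K`. -/
def Homothetic (K : Type*) [Field K] [SMul K V] (Λ Λ' : Submodule O V) : Prop :=
  ∃ lam : K, lam ≠ 0 ∧ (Λ' : Set V) = lam • (Λ : Set V)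

end LatticeDefs

section Lattices

variable {O : Type*} [CommRing O] [IsDomain O] [IsDiscreteValuationRing O]
variable {K : Type*} [Field K] [Algebra O K] [IsFractionRing O K]
variable {G : Type*} [Group G]
variable {V : Type*} [AddCommGroup V] [Module K V] [Module O V] [IsScalarTower O K V]

/-- The submodule `πΛ`. -/
def piSmul (π : O) (Λ : Submodule O V) : Submodule O V :=
  Λ.map (LinearMap.lsmul O V π)

/-- The `O`-linear `G`-action on `V`. -/
def resAct (ρ : Representation K G V) : G → V →ₗ[O] V :=
  fun g => (ρ g).restrictScalars O

/-- `Λ` is invariant: `gΛ = Λ` for all `g ∈ G`. -/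
def IsInvariantSub (ρ : Representation K G V) (Λ : Submodule O V) : Prop :=
  ∀ g : G, Λ.map (resAct ρ g) = Λ

/-- `Λ` is normalised at `v`: `v ∈ Λ` and `v ∉ πΛ`. -/
def IsNormalizedAt (π : O) (Λ : Submodule O V) (v : V) : Prop :=
  v ∈ Λ ∧ v ∉ piSmul π Λ

/-- `Λ` is an invariant lattice, normalised at `v`, maximal under inclusion among
invariant lattices normalised at `v`. -/
def IsMaximalAt (ρ : Representation K G V) (π : O) (Λ : Submodule O V) (v : V) : Prop :=
  IsLattice K Λ ∧ IsInvariantSub ρ Λ ∧ IsNormalizedAt π Λ v ∧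
    ∀ Λ' : Submodule O V, IsLattice K Λ' → IsInvariantSub ρ Λ' → IsNormalizedAt π Λ' v →
      Λ ≤ Λ' → Λ' = Λ

/-- `Λ` is a maximal invariant lattice: maximal with respect to some nonzero `v`. -/
def IsMaximalLattice (ρ : Representation K G V) (π : O) (Λ : Submodule O V) : Prop :=
  ∃ v : V, v ≠ 0 ∧ IsMaximalAt ρ π Λ v

/-- `V` is simple as a `K[G]`-module. -/
def IsIrreducibleRep (ρ : Representation K G V) : Prop :=
  Nontrivial V ∧ ∀ W : Submodule K V, (∀ g : G, ∀ x ∈ W, ρ g x ∈ W) → W = ⊥ ∨ W = ⊤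

/-- The induced `G`-action on the reduction `Λ/πΛ`. -/
noncomputable def redAct (ρ : Representation K G V) (π : O) (Λ : Submodule O V) :
    G → SubQuot (piSmul π Λ) Λ →ₗ[O] SubQuot (piSmul π Λ) Λ :=
  subQuotMap (resAct ρ) (piSmul π Λ) Λ

/-- The map `Λ/πΛ → Λ'/πΛ'` induced by an inclusion `Λ ≤ Λ'` (junk value `0` if
`Λ ≰ Λ'`). -/
noncomputable def redMap (π : O) (Λ Λ' : Submodule O V) :
    SubQuot (piSmul π Λ) Λ →ₗ[O] SubQuot (piSmul π Λ') Λ' :=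
  if h : Λ ≤ Λ' then
    Submodule.mapQ _ _ (Submodule.inclusion h)
      (by
        intro x hx
        have hx' : (x : V) ∈ piSmul π Λ := hx
        have : (x : V) ∈ piSmul π Λ' := Submodule.map_mono h hx'
        simpa [Submodule.mem_comap] using this)
  else 0

/-- `ρ` realises a non-split extension of `A` (a module with action `τA`) by `B`
(a module with action `τB`): there are an invariant lattice `L` and submodules
`U₀ ⊆ T ⊆ U₁` of `L/πL` with `T/U₀ ≅ B`, `U₁/T ≅ A`, and `T/U₀` has no stable
complement in `U₁/U₀` (i.e. the extension `0 → B → U₁/U₀ → A → 0` does not split). -/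
def RealizesExt (ρ : Representation K G V) (π : O)
    {NA : Type*} [AddCommGroup NA] [Module O NA] {NB : Type*} [AddCommGroup NB] [Module O NB]
    (τA : G → NA →ₗ[O] NA) (τB : G → NB →ₗ[O] NB) : Prop :=
  ∃ L : Submodule O V, IsLattice K L ∧ IsInvariantSub ρ L ∧
    ∃ U₀ U₁ T : Submodule O (SubQuot (piSmul π L) L),
      ActStable (redAct ρ π L) U₀ ∧ ActStable (redAct ρ π L) U₁ ∧
      ActStable (redAct ρ π L) T ∧ U₀ ≤ T ∧ T ≤ U₁ ∧
      IsRepIso (subQuotMap (redAct ρ π L) U₀ T) τB ∧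
      IsRepIso (subQuotMap (redAct ρ π L) T U₁) τA ∧
      ¬ ∃ C : Submodule O (SubQuot (piSmul π L) L), ActStable (redAct ρ π L) C ∧
          U₀ ≤ C ∧ C ≤ U₁ ∧ C ⊓ T = U₀ ∧ C ⊔ T = U₁

end Lattices

/-- The underlying family of linear endomorphisms of a representation. -/
def ofRep {R : Type*} [CommSemiring R] {G : Type*} [Monoid G] {M : Type*} [AddCommMonoid M]
    [Module R M] (σ : Representation R G M) : G → M →ₗ[R] M := fun g => σ g

section Correspondences

variable {R : Type*} [CommRing R] {G : Type*}
variable {M : Type*} [AddCommGroup M] [Module R M]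
variable {N : Type*} [AddCommGroup N] [Module R N]
variable {P : Type*} [AddCommGroup P] [Module R P]

/-- The subquotients `A₂/A₁` and `B₂/B₁` are matched by a stable correspondence
`Γ ≤ M × N`: the graph of an equivariant isomorphism between them, pulled back to `M × N`. -/
def SubquotCorr (σ : G → M →ₗ[R] M) (A₁ A₂ : Submodule R M)
    (τ : G → N →ₗ[R] N) (B₁ B₂ : Submodule R N) : Prop :=
  ∃ Γ : Submodule R (M × N),
    (∀ g x y, (x, y) ∈ Γ → (σ g x, τ g y) ∈ Γ) ∧
    (∀ x y, (x, y) ∈ Γ → x ∈ A₂ ∧ y ∈ B₂ ∧ (x ∈ A₁ ↔ y ∈ B₁)) ∧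
    (∀ x ∈ A₂, ∃ y, (x, y) ∈ Γ) ∧ ∀ y ∈ B₂, ∃ x, (x, y) ∈ Γ

theorem SubquotCorr.symm {σ : G → M →ₗ[R] M} {A₁ A₂ : Submodule R M}
    {τ : G → N →ₗ[R] N} {B₁ B₂ : Submodule R N} (h : SubquotCorr σ A₁ A₂ τ B₁ B₂) :
    SubquotCorr τ B₁ B₂ σ A₁ A₂ := by
  obtain ⟨Γ, h1, h2, h3, h4⟩ := h
  refine ⟨Γ.comap (LinearMap.prod (LinearMap.snd R N M) (LinearMap.fst R N M)),
    fun g x y h => h1 g y x h, fun x y h => ?_, fun x hx => h4 x hx, fun y hy => h3 y hy⟩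
  obtain ⟨a, b, c⟩ := h2 y x h
  exact ⟨b, a, c.symm⟩

theorem SubquotCorr.trans {σ : G → M →ₗ[R] M} {A₁ A₂ : Submodule R M}
    {τ : G → N →ₗ[R] N} {B₁ B₂ : Submodule R N} {υ : G → P →ₗ[R] P} {C₁ C₂ : Submodule R P}
    (h : SubquotCorr σ A₁ A₂ τ B₁ B₂) (h' : SubquotCorr τ B₁ B₂ υ C₁ C₂) :
    SubquotCorr σ A₁ A₂ υ C₁ C₂ := by
  obtain ⟨Γ, h1, h2, h3, h4⟩ := h
  obtain ⟨Δ, k1, k2, k3, k4⟩ := h'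
  let Θ : Submodule R (M × P) :=
    { carrier := {p | ∃ y, (p.1, y) ∈ Γ ∧ (y, p.2) ∈ Δ}
      zero_mem' := ⟨0, Γ.zero_mem, Δ.zero_mem⟩
      add_mem' := by
        rintro p q ⟨y, hy, hy'⟩ ⟨z, hz, hz'⟩
        exact ⟨y + z, Γ.add_mem hy hz, Δ.add_mem hy' hz'⟩
      smul_mem' := by
        rintro r p ⟨y, hy, hy'⟩
        exact ⟨r • y, Γ.smul_mem r hy, Δ.smul_mem r hy'⟩ }
  refine ⟨Θ, ?_, ?_, ?_, ?_⟩
  · rintro g x z ⟨y, hy, hy'⟩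
    exact ⟨τ g y, h1 g _ _ hy, k1 g _ _ hy'⟩
  · rintro x z ⟨y, hy, hy'⟩
    obtain ⟨a, b, c⟩ := h2 _ _ hy
    obtain ⟨a', b', c'⟩ := k2 _ _ hy'
    exact ⟨a, b', c.trans c'⟩
  · intro x hx
    obtain ⟨y, hy⟩ := h3 x hx
    obtain ⟨z, hz⟩ := k3 y (h2 _ _ hy).2.1
    exact ⟨z, y, hy, hz⟩
  · intro z hz
    obtain ⟨y, hy⟩ := k4 z hz
    obtain ⟨x, hx⟩ := h4 y (k2 _ _ hy).1
    exact ⟨x, y, hx, hy⟩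

theorem ActStable.inf {σ : G → M →ₗ[R] M} {A B : Submodule R M} (hA : ActStable σ A)
    (hB : ActStable σ B) : ActStable σ (A ⊓ B) :=
  fun g x hx => ⟨hA g x hx.1, hB g x hx.2⟩

theorem ActStable.sup {σ : G → M →ₗ[R] M} {A B : Submodule R M} (hA : ActStable σ A)
    (hB : ActStable σ B) : ActStable σ (A ⊔ B) := by
  intro g x hx
  obtain ⟨a, ha, b, hb, rfl⟩ := Submodule.mem_sup.1 hx
  rw [map_add]
  exact Submodule.add_mem_sup (hA g a ha) (hB g b hb)

theorem ActStable.map {σ : G → M →ₗ[R] M} {τ : G → N →ₗ[R] N} {f : M →ₗ[R] N}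
    (hf : ∀ g x, f (σ g x) = τ g (f x)) {A : Submodule R M} (hA : ActStable σ A) :
    ActStable τ (A.map f) := by
  rintro g _ ⟨x, hx, rfl⟩
  exact ⟨σ g x, hA g x hx, hf g x⟩

theorem ActStable.comap {σ : G → M →ₗ[R] M} {τ : G → N →ₗ[R] N} {f : M →ₗ[R] N}
    (hf : ∀ g x, f (σ g x) = τ g (f x)) {A : Submodule R N} (hA : ActStable τ A) :
    ActStable σ (A.comap f) := by
  intro g x hx
  rw [Submodule.mem_comap, hf]
  exact hA g _ hx

/-- The second isomorphism theorem. -/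
theorem subquotCorr_inf_sup {σ : G → M →ₗ[R] M} {A B : Submodule R M} (hA : ActStable σ A)
    (hB : ActStable σ B) : SubquotCorr σ (A ⊓ B) A σ B (A ⊔ B) := by
  refine ⟨A.comap (LinearMap.fst R M M) ⊓
    B.comap (LinearMap.snd R M M - LinearMap.fst R M M), ?_, ?_, ?_, ?_⟩
  · rintro g x y ⟨hx, hy⟩
    refine ⟨hA g x hx, ?_⟩
    have := hB g _ hy
    simpa using this
  · rintro x y ⟨hx, hy⟩
    have hx' : x ∈ A := hx
    have hy' : y - x ∈ B := hy
    refine ⟨hx', ?_, ?_⟩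
    · have := Submodule.add_mem_sup hx' hy'
      simpa using this
    · constructor
      · intro h
        simpa using B.add_mem hy' h.2
      · intro h
        exact ⟨hx', by simpa using B.sub_mem h hy'⟩
  · intro x hx
    exact ⟨x, hx, by simp⟩
  · intro y hy
    obtain ⟨a, ha, b, hb, rfl⟩ := Submodule.mem_sup.1 hy
    exact ⟨a, ha, by simpa using hb⟩

theorem subquotCorr_map {σ : G → M →ₗ[R] M} {τ : G → N →ₗ[R] N} {f : M →ₗ[R] N}
    (hf : ∀ g x, f (σ g x) = τ g (f x)) (hinj : Function.Injective f) {A B : Submodule R M}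
    (hB : ActStable σ B) : SubquotCorr σ A B τ (A.map f) (B.map f) := by
  refine ⟨B.map (LinearMap.id.prod f), ?_, ?_, ?_, ?_⟩
  · rintro g x y ⟨z, hz, h⟩
    obtain ⟨rfl, rfl⟩ := Prod.ext_iff.1 h
    exact ⟨σ g z, hB g z hz, Prod.ext rfl (hf g z)⟩
  · rintro x y ⟨z, hz, h⟩
    obtain ⟨rfl, rfl⟩ := Prod.ext_iff.1 h
    refine ⟨hz, ⟨z, hz, rfl⟩, fun h => ⟨z, h, rfl⟩, ?_⟩
    rintro ⟨w, hw, h⟩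
    exact (hinj h) ▸ hw
  · intro x hx
    exact ⟨f x, x, hx, rfl⟩
  · rintro _ ⟨x, hx, rfl⟩
    exact ⟨x, x, hx, rfl⟩

theorem subQuotMap_mk {σ : G → M →ₗ[R] M} {A B : Submodule R M} (hA : ActStable σ A)
    (hB : ActStable σ B) (g : G) (x : B) :
    subQuotMap σ A B g (Submodule.Quotient.mk x) =
      Submodule.Quotient.mk ⟨σ g x, hB g x x.2⟩ := by
  rw [subQuotMap, dif_pos ⟨hB g, fun x _ => hA g x⟩]
  rfl

theorem isRepIso_of_surjective {σ : G → M →ₗ[R] M} {τ : G → N →ₗ[R] N}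
    (f : P →ₗ[R] M) (k : P →ₗ[R] N) (hf : Function.Surjective f) (hk : Function.Surjective k)
    (hker : ∀ p, f p = 0 ↔ k p = 0)
    (hact : ∀ g p, ∃ q, f q = σ g (f p) ∧ k q = τ g (k p)) : IsRepIso σ τ := by
  have hE : LinearMap.ker f = LinearMap.ker k := by
    ext p
    exact hker p
  let e : M ≃ₗ[R] N := (f.quotKerEquivOfSurjective hf).symm ≪≫ₗ
    Submodule.quotEquivOfEq _ _ hE ≪≫ₗ k.quotKerEquivOfSurjective hk
  have he : ∀ p, e (f p) = k p := by
    intro p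
    have : (f.quotKerEquivOfSurjective hf).symm (f p) = Submodule.Quotient.mk p := by
      rw [LinearEquiv.symm_apply_eq]
      rfl
    simp only [e, LinearEquiv.trans_apply, this]
    rfl
  refine ⟨e, fun g x => ?_⟩
  obtain ⟨p, rfl⟩ := hf x
  obtain ⟨q, hq, hq'⟩ := hact g p
  rw [← hq, he, he, hq']

theorem SubquotCorr.isRepIso {σ : G → M →ₗ[R] M} {A₁ A₂ : Submodule R M}
    {τ : G → N →ₗ[R] N} {B₁ B₂ : Submodule R N} (h : SubquotCorr σ A₁ A₂ τ B₁ B₂)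
    (hA₁ : ActStable σ A₁) (hA₂ : ActStable σ A₂) (hB₁ : ActStable τ B₁)
    (hB₂ : ActStable τ B₂) : IsRepIso (subQuotMap σ A₁ A₂) (subQuotMap τ B₁ B₂) := by
  obtain ⟨Γ, h1, h2, h3, h4⟩ := h
  let f : Γ →ₗ[R] A₂ := (LinearMap.fst R M N ∘ₗ Γ.subtype).codRestrict A₂
    fun p => (h2 p.1.1 p.1.2 p.2).1
  let k : Γ →ₗ[R] B₂ := (LinearMap.snd R M N ∘ₗ Γ.subtype).codRestrict B₂
    fun p => (h2 p.1.1 p.1.2 p.2).2.1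
  refine isRepIso_of_surjective (Submodule.mkQ _ ∘ₗ f) (Submodule.mkQ _ ∘ₗ k) ?_ ?_ ?_ ?_
  · refine (Submodule.mkQ_surjective _).comp ?_
    rintro ⟨x, hx⟩
    obtain ⟨y, hy⟩ := h3 x hx
    exact ⟨⟨(x, y), hy⟩, rfl⟩
  · refine (Submodule.mkQ_surjective _).comp ?_
    rintro ⟨y, hy⟩
    obtain ⟨x, hx⟩ := h4 y hy
    exact ⟨⟨(x, y), hx⟩, rfl⟩
  · intro p
    simp only [LinearMap.comp_apply, Submodule.mkQ_apply, Submodule.Quotient.mk_eq_zero]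
    exact (h2 p.1.1 p.1.2 p.2).2.2
  · intro g p
    refine ⟨⟨(σ g p.1.1, τ g p.1.2), h1 g _ _ p.2⟩, ?_, ?_⟩
    · exact (subQuotMap_mk hA₁ hA₂ g (f p)).symm
    · exact (subQuotMap_mk hB₁ hB₂ g (k p)).symm

theorem isRepIso_iff_subquotCorr {σ : G → M →ₗ[R] M} {A B : Submodule R M}
    {τ : G → N →ₗ[R] N} (hA : ActStable σ A) (hB : ActStable σ B) :
    IsRepIso (subQuotMap σ A B) τ ↔ SubquotCorr σ A B τ ⊥ ⊤ := by
  constructor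
  · rintro ⟨e, he⟩
    refine ⟨LinearMap.range (B.subtype.prod (e.toLinearMap ∘ₗ Submodule.mkQ _)), ?_, ?_, ?_, ?_⟩
    · rintro g x y ⟨z, h⟩
      obtain ⟨rfl, rfl⟩ := Prod.ext_iff.1 h
      refine ⟨⟨σ g z, hB g z z.2⟩, Prod.ext rfl ?_⟩
      have := he g (Submodule.Quotient.mk z)
      rw [subQuotMap_mk hA hB] at this
      exact this
    · rintro x y ⟨z, h⟩
      obtain ⟨rfl, rfl⟩ := Prod.ext_iff.1 h
      refine ⟨z.2, trivial, ?_⟩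
      rw [Submodule.mem_bot]
      change _ ↔ e (Submodule.Quotient.mk z) = 0
      rw [LinearEquiv.map_eq_zero_iff, Submodule.Quotient.mk_eq_zero]
      rfl
    · intro x hx
      exact ⟨_, ⟨x, hx⟩, rfl⟩
    · intro y _
      obtain ⟨z, hz⟩ := Submodule.Quotient.mk_surjective _ (e.symm y)
      refine ⟨z, z, Prod.ext rfl ?_⟩
      change e (Submodule.Quotient.mk z) = y
      rw [hz, LinearEquiv.apply_symm_apply]
  · rintro ⟨Γ, h1, h2, h3, h4⟩
    let f : Γ →ₗ[R] B := (LinearMap.fst R M N ∘ₗ Γ.subtype).codRestrict B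
      fun p => (h2 p.1.1 p.1.2 p.2).1
    refine isRepIso_of_surjective (Submodule.mkQ _ ∘ₗ f) (LinearMap.snd R M N ∘ₗ Γ.subtype)
      ?_ ?_ ?_ ?_
    · refine (Submodule.mkQ_surjective _).comp ?_
      rintro ⟨x, hx⟩
      obtain ⟨y, hy⟩ := h3 x hx
      exact ⟨⟨(x, y), hy⟩, rfl⟩
    · intro y
      obtain ⟨x, hx⟩ := h4 y trivial
      exact ⟨⟨(x, y), hx⟩, rfl⟩
    · intro p
      simp only [LinearMap.comp_apply, Submodule.mkQ_apply, Submodule.Quotient.mk_eq_zero]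
      exact (h2 p.1.1 p.1.2 p.2).2.2
    · intro g p
      refine ⟨⟨(σ g p.1.1, τ g p.1.2), h1 g _ _ p.2⟩, ?_, rfl⟩
      exact (subQuotMap_mk hA hB g (f p)).symm

/-! ### Preimages of submodules of a subquotient -/

/-- The preimage in `M` of a submodule of the subquotient `B / A`. -/
def liftSub {A B : Submodule R M} (U : Submodule R (SubQuot A B)) : Submodule R M :=
  (U.comap (Submodule.mkQ _)).map B.subtype

theorem mem_liftSub {A B : Submodule R M} {U : Submodule R (SubQuot A B)} {x : M} :
    x ∈ liftSub U ↔ ∃ h : x ∈ B, (Submodule.Quotient.mk ⟨x, h⟩ : SubQuot A B) ∈ U := by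
  constructor
  · rintro ⟨⟨y, hy⟩, hU, rfl⟩
    exact ⟨hy, hU⟩
  · rintro ⟨h, hU⟩
    exact ⟨⟨x, h⟩, hU, rfl⟩

theorem liftSub_le_liftSub {A B : Submodule R M} {U U' : Submodule R (SubQuot A B)} :
    liftSub U ≤ liftSub U' ↔ U ≤ U' := by
  constructor
  · intro h u hu
    obtain ⟨⟨x, hx⟩, rfl⟩ := Submodule.Quotient.mk_surjective _ u
    exact (mem_liftSub.1 (h (mem_liftSub.2 ⟨hx, hu⟩))).2
  · intro h x hx
    obtain ⟨hx, hu⟩ := mem_liftSub.1 hx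
    exact mem_liftSub.2 ⟨hx, h hu⟩

theorem liftSub_le {A B : Submodule R M} (U : Submodule R (SubQuot A B)) : liftSub U ≤ B :=
  fun _ hx => (mem_liftSub.1 hx).1

theorem le_liftSub {A B : Submodule R M} (hAB : A ≤ B) (U : Submodule R (SubQuot A B)) :
    A ≤ liftSub U := by
  intro x hx
  refine mem_liftSub.2 ⟨hAB hx, ?_⟩
  rw [(Submodule.Quotient.mk_eq_zero _).2 (show (⟨x, hAB hx⟩ : B) ∈ A.comap B.subtype from hx)]
  exact U.zero_mem

theorem liftSub_bot {A B : Submodule R M} (hAB : A ≤ B) :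
    liftSub (⊥ : Submodule R (SubQuot A B)) = A := by
  refine le_antisymm (fun x hx => ?_) (le_liftSub hAB _)
  obtain ⟨h, hx⟩ := mem_liftSub.1 hx
  rw [Submodule.mem_bot, Submodule.Quotient.mk_eq_zero] at hx
  exact hx

theorem liftSub_top {A B : Submodule R M} : liftSub (⊤ : Submodule R (SubQuot A B)) = B :=
  le_antisymm (liftSub_le _) fun _ hx => mem_liftSub.2 ⟨hx, trivial⟩

theorem actStable_liftSub {σ : G → M →ₗ[R] M} {A B : Submodule R M} (hA : ActStable σ A)
    (hB : ActStable σ B) {U : Submodule R (SubQuot A B)}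
    (hU : ActStable (subQuotMap σ A B) U) : ActStable σ (liftSub U) := by
  intro g x hx
  obtain ⟨h, hx⟩ := mem_liftSub.1 hx
  have := hU g _ hx
  rw [subQuotMap_mk hA hB] at this
  exact mem_liftSub.2 ⟨_, this⟩

theorem exists_liftSub_eq {σ : G → M →ₗ[R] M} {A B : Submodule R M} (hA : ActStable σ A)
    (hB : ActStable σ B) {X : Submodule R M} (hX : ActStable σ X) (hAX : A ≤ X) (hXB : X ≤ B) :
    ∃ U : Submodule R (SubQuot A B), ActStable (subQuotMap σ A B) U ∧ liftSub U = X := by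
  refine ⟨(X.comap B.subtype).map (Submodule.mkQ _), ?_, ?_⟩
  · rintro g _ ⟨x, hx, rfl⟩
    exact ⟨⟨σ g x, hB g x x.2⟩, hX g x hx, (subQuotMap_mk hA hB g x).symm⟩
  · ext x
    rw [mem_liftSub]
    constructor
    · rintro ⟨h, y, hy, hxy⟩
      have hd : y - ⟨x, h⟩ ∈ A.comap B.subtype := (Submodule.Quotient.eq _).1 hxy
      have := X.sub_mem hy (hAX (Submodule.mem_comap.1 hd))
      simpa using this
    · intro hx
      exact ⟨hXB hx, ⟨x, hXB hx⟩, hx, rfl⟩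

theorem subquotCorr_liftSub {σ : G → M →ₗ[R] M} {A B : Submodule R M} (hA : ActStable σ A)
    (hB : ActStable σ B) {U₁ U₂ : Submodule R (SubQuot A B)}
    (hU₂ : ActStable (subQuotMap σ A B) U₂) :
    SubquotCorr σ (liftSub U₁) (liftSub U₂) (subQuotMap σ A B) U₁ U₂ := by
  refine ⟨(U₂.comap (Submodule.mkQ _)).map (B.subtype.prod (Submodule.mkQ _)), ?_, ?_, ?_, ?_⟩
  · rintro g x y ⟨z, hz, h⟩
    obtain ⟨rfl, rfl⟩ := Prod.ext_iff.1 h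
    have hz' := hU₂ g _ hz
    rw [Submodule.mkQ_apply, subQuotMap_mk hA hB] at hz'
    exact ⟨⟨σ g z, hB g z z.2⟩, hz', Prod.ext rfl (subQuotMap_mk hA hB g z).symm⟩
  · rintro x y ⟨z, hz, h⟩
    obtain ⟨rfl, rfl⟩ := Prod.ext_iff.1 h
    refine ⟨mem_liftSub.2 ⟨z.2, hz⟩, hz, ?_⟩
    exact mem_liftSub.trans ⟨fun h => h.2, fun h => ⟨z.2, h⟩⟩
  · intro x hx
    obtain ⟨h, hx⟩ := mem_liftSub.1 hx
    exact ⟨_, ⟨x, h⟩, hx, rfl⟩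
  · intro y hy
    obtain ⟨z, rfl⟩ := Submodule.Quotient.mk_surjective _ y
    exact ⟨z, z, hy, rfl⟩

end Correspondences

/-! ### Multiplicities of simple factors -/

section Factors

variable {R : Type*} [CommRing R] {G : Type*}
variable {M : Type*} [AddCommGroup M] [Module R M]
variable {N : Type*} [AddCommGroup N] [Module R N]

/-- `B / A` is isomorphic to `(N, τ)`, for stable `A ≤ B`. -/
structure IsFactor (σ : G → M →ₗ[R] M) (τ : G → N →ₗ[R] N) (A B : Submodule R M) : Prop where
  le : A ≤ B
  left : ActStable σ A
  right : ActStable σ B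
  corr : SubquotCorr σ A B τ ⊥ ⊤

/-- Some chain from `A` to `B` has at least `n` steps isomorphic to `(N, τ)`. -/
inductive HasFactors (σ : G → M →ₗ[R] M) (τ : G → N →ₗ[R] N) :
    ℕ → Submodule R M → Submodule R M → Prop
  | zero {A B} : A ≤ B → HasFactors σ τ 0 A B
  | succ {n A X Y B} : HasFactors σ τ n A X → IsFactor σ τ X Y → Y ≤ B →
      HasFactors σ τ (n + 1) A B

variable {σ : G → M →ₗ[R] M} {τ : G → N →ₗ[R] N}

theorem IsFactor.eq_or_eq {A B : Submodule R M} (h : IsFactor σ τ A B) (hτ : IsSimpleAct τ)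
    {X : Submodule R M} (hX : ActStable σ X) (hAX : A ≤ X) (hXB : X ≤ B) : X = A ∨ X = B := by
  obtain ⟨Γ, h1, h2, h3, h4⟩ := h.corr
  have hmem : ∀ y, y ∈ (Γ ⊓ X.comap (LinearMap.fst R M N)).map (LinearMap.snd R M N) ↔
      ∃ x ∈ X, (x, y) ∈ Γ := by
    intro y
    constructor
    · rintro ⟨⟨x, y⟩, ⟨hp, hx⟩, rfl⟩
      exact ⟨x, hx, hp⟩
    · rintro ⟨x, hx, hp⟩
      exact ⟨(x, y), ⟨hp, hx⟩, rfl⟩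
  rcases hτ.2 ((Γ ⊓ X.comap (LinearMap.fst R M N)).map (LinearMap.snd R M N)) (by
      intro g y hy
      obtain ⟨x, hx, hp⟩ := (hmem y).1 hy
      exact (hmem _).2 ⟨σ g x, hX g x hx, h1 g _ _ hp⟩) with hY | hY
  · left
    refine le_antisymm (fun x hx => ?_) hAX
    obtain ⟨y, hy⟩ := h3 x (hXB hx)
    refine (h2 _ _ hy).2.2.2 ?_
    rw [← hY, hmem]
    exact ⟨x, hx, hy⟩
  · right
    refine le_antisymm hXB fun b hb => ?_
    obtain ⟨y, hy⟩ := h3 b hb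
    obtain ⟨x, hx, hxy⟩ := (hmem y).1 (hY ▸ trivial)
    have hd : (b - x, (0 : N)) ∈ Γ := by simpa using Γ.sub_mem hy hxy
    have := X.add_mem (hAX ((h2 _ _ hd).2.2.2 (Submodule.zero_mem _))) hx
    simpa using this

theorem IsFactor.lt {A B : Submodule R M} (h : IsFactor σ τ A B) (hτ : IsSimpleAct τ) :
    A < B := by
  refine lt_of_le_of_ne h.le ?_
  rintro rfl
  obtain ⟨Γ, h1, h2, h3, h4⟩ := h.corr
  obtain ⟨y, hy⟩ := @exists_ne _ hτ.1 (0 : N)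
  obtain ⟨x, hx⟩ := h4 y trivial
  obtain ⟨hx, -, h⟩ := h2 _ _ hx
  exact hy (h.1 hx)

theorem IsFactor.smul_le {A B : Submodule R M} (h : IsFactor σ τ A B) {π : R}
    (hπ : ∀ x : N, π • x = 0) : π • B ≤ A := by
  obtain ⟨Γ, h1, h2, h3, h4⟩ := h.corr
  rintro _ ⟨b, hb, rfl⟩
  obtain ⟨y, hy⟩ := h3 b hb
  have := Γ.smul_mem π hy
  rw [Prod.smul_mk, hπ] at this
  exact (h2 _ _ this).2.2.2 (Submodule.zero_mem _)

theorem IsFactor.sup {A B C : Submodule R M} (h : IsFactor σ τ A B) (hC : ActStable σ C)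
    (hBC : B ⊓ C ≤ A) : IsFactor σ τ (A ⊔ C) (B ⊔ C) := by
  refine ⟨sup_le_sup_right h.le C, h.left.sup hC, h.right.sup hC, ?_⟩
  have h1 := subquotCorr_inf_sup h.right (h.left.sup hC)
  have e1 : B ⊓ (A ⊔ C) = A := by
    rw [inf_comm, sup_inf_assoc_of_le C h.le, sup_eq_left, inf_comm]
    exact hBC
  have e2 : B ⊔ (A ⊔ C) = B ⊔ C := by rw [← sup_assoc, sup_eq_left.2 h.le]
  rw [e1, e2] at h1
  exact h1.symm.trans h.corr

theorem IsFactor.inf {A B C : Submodule R M} (h : IsFactor σ τ A B) (hC : ActStable σ C)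
    (hBC : A ⊔ (B ⊓ C) = B) : IsFactor σ τ (A ⊓ C) (B ⊓ C) := by
  refine ⟨inf_le_inf_right C h.le, h.left.inf hC, h.right.inf hC, ?_⟩
  have h1 := subquotCorr_inf_sup (h.right.inf hC) h.left
  have e1 : B ⊓ C ⊓ A = A ⊓ C := by rw [inf_right_comm, inf_eq_right.2 h.le]
  rw [e1, sup_comm, hBC] at h1
  exact h1.trans h.corr

theorem IsFactor.map {f : M →ₗ[R] M} (hf : ∀ g x, f (σ g x) = σ g (f x))
    (hinj : Function.Injective f) {A B : Submodule R M} (h : IsFactor σ τ A B) :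
    IsFactor σ τ (A.map f) (B.map f) :=
  ⟨Submodule.map_mono h.le, h.left.map hf, h.right.map hf,
    (subquotCorr_map hf hinj h.right).symm.trans h.corr⟩

theorem IsFactor.comap {f : M →ₗ[R] M} (hf : ∀ g x, f (σ g x) = σ g (f x))
    (hinj : Function.Injective f) {A B : Submodule R M} (h : IsFactor σ τ A B)
    (hB : B ≤ LinearMap.range f) : IsFactor σ τ (A.comap f) (B.comap f) := by
  refine ⟨Submodule.comap_mono h.le, h.left.comap hf, h.right.comap hf, ?_⟩
  have h1 := subquotCorr_map hf hinj (A := A.comap f) (h.right.comap hf)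
  rw [Submodule.map_comap_eq_of_le hB, Submodule.map_comap_eq_of_le (h.le.trans hB)] at h1
  exact h1.trans h.corr

namespace HasFactors

theorem le {n : ℕ} {A B : Submodule R M} (h : HasFactors σ τ n A B) : A ≤ B := by
  induction h with
  | zero h => exact h
  | succ _ h1 h2 ih => exact ih.trans (h1.le.trans h2)

theorem mono_right {n : ℕ} {A B C : Submodule R M} (h : HasFactors σ τ n A B) (hBC : B ≤ C) :
    HasFactors σ τ n A C := by
  cases h with
  | zero h => exact .zero (h.trans hBC)
  | succ h h1 h2 => exact .succ h h1 (h2.trans hBC)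

theorem trans {m n : ℕ} {A B C : Submodule R M} (h : HasFactors σ τ m A B)
    (h' : HasFactors σ τ n B C) : HasFactors σ τ (m + n) A C := by
  induction h' with
  | zero h1 => exact h.mono_right h1
  | succ _ h1 h2 ih => exact .succ (ih h) h1 h2

theorem mono_left {n : ℕ} {A B C : Submodule R M} (h : HasFactors σ τ n B C) (hAB : A ≤ B) :
    HasFactors σ τ n A C := by
  simpa using (HasFactors.zero hAB).trans h

theorem _root_.IsFactor.hasFactors {A B : Submodule R M} (h : IsFactor σ τ A B) :
    HasFactors σ τ 1 A B :=
  .succ (.zero le_rfl) h le_rfl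

theorem exists_isFactor {A B : Submodule R M} (h : HasFactors σ τ 1 A B) :
    ∃ X Y, A ≤ X ∧ IsFactor σ τ X Y ∧ Y ≤ B := by
  cases h with
  | succ h h1 h2 => exact ⟨_, _, h.le, h1, h2⟩

theorem of_le {m n : ℕ} {A B : Submodule R M} (h : HasFactors σ τ n A B) (hmn : m ≤ n) :
    HasFactors σ τ m A B := by
  induction h generalizing m with
  | zero h => rw [Nat.le_zero.1 hmn]; exact .zero h
  | succ h h1 h2 ih =>
    rcases Nat.lt_or_eq_of_le hmn with hlt | rfl
    · exact (ih (Nat.lt_succ_iff.1 hlt)).mono_right (h1.le.trans h2)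
    · exact .succ h h1 h2

theorem eq_zero_of_self (hτ : IsSimpleAct τ) {n : ℕ} {A : Submodule R M}
    (h : HasFactors σ τ n A A) : n = 0 := by
  cases h with
  | zero => rfl
  | succ h h1 h2 => exact absurd (h.le.trans_lt (h1.lt hτ)) (not_lt_of_ge h2)

/-- Each factor of a chain shows up in exactly one of the traces of the chain
below and above a stable submodule `C`. -/
theorem split (hτ : IsSimpleAct τ) {n : ℕ} {A B C : Submodule R M}
    (h : HasFactors σ τ n A B) (hC : ActStable σ C) :
    ∃ a b, a + b = n ∧ HasFactors σ τ a (A ⊓ C) (B ⊓ C) ∧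
      HasFactors σ τ b (A ⊔ C) (B ⊔ C) := by
  induction h with
  | zero h =>
    exact ⟨0, 0, rfl, .zero (inf_le_inf_right C h), .zero (sup_le_sup_right h C)⟩
  | @succ n A X Y B h h1 h2 ih =>
    obtain ⟨a, b, hab, ha, hb⟩ := ih
    have hB := inf_le_inf_right C h2
    have hB' := sup_le_sup_right h2 C
    rcases h1.eq_or_eq hτ (h1.left.sup (h1.right.inf hC)) le_sup_left
      (sup_le h1.le inf_le_left) with he | he
    · have hle : Y ⊓ C ≤ X := sup_eq_left.1 he
      exact ⟨a, b + 1, by omega, ha.mono_right ((inf_le_inf_right C h1.le).trans hB),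
        .succ hb (h1.sup hC hle) hB'⟩
    · exact ⟨a + 1, b, by omega, .succ ha (h1.inf hC he) hB,
        hb.mono_right ((sup_le_sup_right h1.le C).trans hB')⟩

theorem split_of_le (hτ : IsSimpleAct τ) {n : ℕ} {A B C : Submodule R M}
    (h : HasFactors σ τ n A B) (hC : ActStable σ C) (hAC : A ≤ C) (hCB : C ≤ B) :
    ∃ a b, a + b = n ∧ HasFactors σ τ a A C ∧ HasFactors σ τ b C B := by
  obtain ⟨a, b, hab, ha, hb⟩ := h.split hτ hC
  rw [inf_eq_left.2 hAC, inf_eq_right.2 hCB] at ha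
  rw [sup_eq_right.2 hAC, sup_eq_left.2 hCB] at hb
  exact ⟨a, b, hab, ha, hb⟩

theorem of_sup (hτ : IsSimpleAct τ) {n : ℕ} {A B : Submodule R M} (hA : ActStable σ A)
    (h : HasFactors σ τ n B (A ⊔ B)) : HasFactors σ τ n (A ⊓ B) A := by
  obtain ⟨a, b, rfl, ha, hb⟩ := h.split hτ hA
  rw [sup_eq_left.2 (le_sup_left : A ≤ A ⊔ B), sup_comm B A] at hb
  rw [hb.eq_zero_of_self hτ, add_zero]
  rwa [inf_comm B A, inf_eq_right.2 (le_sup_left : A ≤ A ⊔ B)] at ha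

theorem map {f : M →ₗ[R] M} (hf : ∀ g x, f (σ g x) = σ g (f x))
    (hinj : Function.Injective f) {n : ℕ} {A B : Submodule R M} (h : HasFactors σ τ n A B) :
    HasFactors σ τ n (A.map f) (B.map f) := by
  induction h with
  | zero h => exact .zero (Submodule.map_mono h)
  | succ h h1 h2 ih => exact .succ ih (h1.map hf hinj) (Submodule.map_mono h2)

theorem comap {f : M →ₗ[R] M} (hf : ∀ g x, f (σ g x) = σ g (f x))
    (hinj : Function.Injective f) {n : ℕ} {A B : Submodule R M} (h : HasFactors σ τ n A B)
    (hB : B ≤ LinearMap.range f) : HasFactors σ τ n (A.comap f) (B.comap f) := by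
  induction h with
  | zero h => exact .zero (Submodule.comap_mono h)
  | succ h h1 h2 ih =>
    exact .succ (ih ((h1.le.trans h2).trans hB)) (h1.comap hf hinj (h2.trans hB))
      (Submodule.comap_mono h2)

/-- An irreducible subquotient carries at most one factor, and then is isomorphic to it. -/
theorem isFactor_of_isIrredSubquot (hτ : IsSimpleAct τ) {n : ℕ} {A B : Submodule R M}
    (hAB : IsIrredSubquot σ A B) (h : HasFactors σ τ n A B) (hn : n ≠ 0) :
    n = 1 ∧ IsFactor σ τ A B := by
  cases h with
  | zero => exact absurd rfl hn
  | @succ n _ X Y _ h h1 h2 =>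
    have hlt := h1.lt hτ
    have hX : X = A := (hAB.2.2.2 X h1.left h.le (h1.le.trans h2)).resolve_right
      (hlt.trans_le h2).ne
    have hY : Y = B := (hAB.2.2.2 Y h1.right (h.le.trans h1.le) h2).resolve_left
      (h.le.trans_lt hlt).ne'
    subst hX hY
    rw [h.eq_zero_of_self hτ]
    exact ⟨rfl, h1⟩

end HasFactors

/-- A chain of irreducible subquotients, at most one of which is a factor, carries at most one
factor. -/
theorem not_hasFactors_two_of_chain (hτ : IsSimpleAct τ) {c : ℕ}
    (t : Fin (c + 1) → Submodule R M)
    (hstep : ∀ k : Fin c, IsIrredSubquot σ (t k.castSucc) (t k.succ))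
    (huniq : ∀ k l : Fin c, IsFactor σ τ (t k.castSucc) (t k.succ) →
      IsFactor σ τ (t l.castSucc) (t l.succ) → k = l) :
    ¬ HasFactors σ τ 2 (t 0) (t (Fin.last c)) := by
  have key : ∀ k : Fin (c + 1), t 0 ≤ t k ∧ ∀ n, HasFactors σ τ n (t 0) (t k) → n ≠ 0 →
      n = 1 ∧ ∃ l : Fin c, l.castSucc < k ∧ IsFactor σ τ (t l.castSucc) (t l.succ) := by
    intro k
    induction k using Fin.induction with
    | zero => exact ⟨le_rfl, fun n h hn => absurd (h.eq_zero_of_self hτ) hn⟩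
    | succ k ih =>
      refine ⟨ih.1.trans (hstep k).2.2.1.le, fun n h hn => ?_⟩
      obtain ⟨a, b, rfl, ha, hb⟩ := h.split_of_le hτ (hstep k).1 ih.1 (hstep k).2.2.1.le
      by_cases ha0 : a = 0
      · subst ha0
        obtain ⟨h1, h2⟩ := hb.isFactor_of_isIrredSubquot hτ (hstep k) (by omega)
        exact ⟨by omega, k, Fin.castSucc_lt_succ, h2⟩
      · obtain ⟨h1, l, hl, h2⟩ := ih.2 a ha ha0
        have hb0 : b = 0 := by
          by_contra hb0
          obtain ⟨-, h3⟩ := hb.isFactor_of_isIrredSubquot hτ (hstep k) hb0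
          rw [huniq l k h2 h3] at hl
          exact lt_irrefl _ hl
        exact ⟨by omega, l, hl.trans Fin.castSucc_lt_succ, h2⟩
  intro h
  have := ((key _).2 2 h (by norm_num)).1
  omega

end Factors

/-! ### Scaling and commensurable submodules -/

section Scaling

variable {R : Type*} [CommRing R] {G : Type*}
variable {M : Type*} [AddCommGroup M] [Module R M]
variable {N : Type*} [AddCommGroup N] [Module R N]
variable {N' : Type*} [AddCommGroup N'] [Module R N']
variable {σ : G → M →ₗ[R] M} {τ : G → N →ₗ[R] N} {υ : G → N' →ₗ[R] N'}

theorem smul_eq_map_lsmul (r : R) (A : Submodule R M) :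
    r • A = A.map (LinearMap.lsmul R M r) := rfl

theorem submodule_smul_mono (r : R) {A B : Submodule R M} (h : A ≤ B) : r • A ≤ r • B :=
  Submodule.map_mono h

theorem submodule_smul_le (r : R) (A : Submodule R M) : r • A ≤ A := by
  rintro _ ⟨x, hx, rfl⟩
  exact A.smul_mem r hx

theorem lsmul_comm (r : R) (g : G) (x : M) :
    LinearMap.lsmul R M r (σ g x) = σ g (LinearMap.lsmul R M r x) := by
  simp

theorem ActStable.smul {A : Submodule R M} (h : ActStable σ A) (r : R) : ActStable σ (r • A) :=
  h.map (lsmul_comm r)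

/-- `A` and `B` contain `π`-power multiples of each other. -/
def PowCommensurable (π : R) (A B : Submodule R M) : Prop :=
  (∃ n : ℕ, π ^ n • A ≤ B) ∧ ∃ n : ℕ, π ^ n • B ≤ A

theorem PowCommensurable.symm {π : R} {A B : Submodule R M} (h : PowCommensurable π A B) :
    PowCommensurable π B A :=
  ⟨h.2, h.1⟩

theorem exists_pow_smul_le_trans {π : R} {A B C : Submodule R M}
    (h : ∃ n : ℕ, π ^ n • A ≤ B) (h' : ∃ n : ℕ, π ^ n • B ≤ C) :
    ∃ n : ℕ, π ^ n • A ≤ C := by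
  obtain ⟨m, hm⟩ := h
  obtain ⟨n, hn⟩ := h'
  refine ⟨n + m, ?_⟩
  rw [pow_add, mul_smul]
  exact (submodule_smul_mono _ hm).trans hn

theorem exists_pow_smul_le_of_le {π : R} {A B : Submodule R M} (h : A ≤ B) :
    ∃ n : ℕ, π ^ n • A ≤ B :=
  ⟨0, by simpa using h⟩

theorem PowCommensurable.trans {π : R} {A B C : Submodule R M} (h : PowCommensurable π A B)
    (h' : PowCommensurable π B C) : PowCommensurable π A C :=
  ⟨exists_pow_smul_le_trans h.1 h'.1, exists_pow_smul_le_trans h'.2 h.2⟩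

theorem commensurable_pow_smul (π : R) (n : ℕ) (A : Submodule R M) :
    PowCommensurable π A (π ^ n • A) :=
  ⟨⟨n, le_rfl⟩, exists_pow_smul_le_of_le (submodule_smul_le _ _)⟩

theorem PowCommensurable.of_le_of_le {π : R} {A B C X : Submodule R M}
    (hB : PowCommensurable π A B) (hC : PowCommensurable π A C) (hBX : B ≤ X) (hXC : X ≤ C) :
    PowCommensurable π A X :=
  ⟨exists_pow_smul_le_trans hB.1 (exists_pow_smul_le_of_le hBX),
    exists_pow_smul_le_trans (exists_pow_smul_le_of_le hXC) hC.2⟩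

theorem PowCommensurable.inf {π : R} {A B C : Submodule R M}
    (hB : PowCommensurable π A B) (hC : PowCommensurable π A C) : PowCommensurable π A (B ⊓ C) := by
  obtain ⟨m, hm⟩ := hB.1
  obtain ⟨n, hn⟩ := hC.1
  refine ⟨⟨m + n, le_inf ?_ ?_⟩,
    exists_pow_smul_le_trans (exists_pow_smul_le_of_le inf_le_left) hB.2⟩
  · rw [pow_add, mul_smul]
    exact (submodule_smul_mono _ (submodule_smul_le _ _)).trans hm
  · rw [pow_add, mul_comm, mul_smul]
    exact (submodule_smul_mono _ (submodule_smul_le _ _)).trans hn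

theorem PowCommensurable.sup {π : R} {A B C : Submodule R M}
    (hB : PowCommensurable π A B) (hC : PowCommensurable π A C) : PowCommensurable π A (B ⊔ C) := by
  obtain ⟨m, hm⟩ := hB.2
  obtain ⟨n, hn⟩ := hC.2
  refine ⟨exists_pow_smul_le_trans hB.1 (exists_pow_smul_le_of_le le_sup_left), m + n, ?_⟩
  rw [Submodule.smul_sup']
  refine sup_le ?_ ?_
  · rw [pow_add, mul_comm, mul_smul]
    exact (submodule_smul_le _ _).trans hm
  · rw [pow_add, mul_smul]
    exact (submodule_smul_le _ _).trans hn

theorem injective_lsmul_pow {π : R} (hπ : Function.Injective (LinearMap.lsmul R M π)) (n : ℕ) :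
    Function.Injective (LinearMap.lsmul R M (π ^ n)) := by
  induction n with
  | zero => intro x y h; simpa using h
  | succ n ih =>
    intro x y h
    refine hπ (ih ?_)
    simpa [pow_succ', mul_smul] using h

theorem hasFactors_smul_iff {r : R} (hr : Function.Injective (LinearMap.lsmul R M r)) {n : ℕ}
    {A B : Submodule R M} : HasFactors σ τ n (r • A) (r • B) ↔ HasFactors σ τ n A B := by
  refine ⟨fun h => ?_, fun h => h.map (lsmul_comm r) hr⟩
  have := h.comap (lsmul_comm r) hr (LinearMap.map_le_range)
  rwa [smul_eq_map_lsmul, smul_eq_map_lsmul, Submodule.comap_map_eq_of_injective hr,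
    Submodule.comap_map_eq_of_injective hr] at this

theorem hasFactors_le_of_pow {π : R} (hπ : Function.Injective (LinearMap.lsmul R M π))
    (hτ : IsSimpleAct τ) {A : Submodule R M} (hA : ActStable σ A)
    (h2 : ¬ HasFactors σ τ 2 (π • A) A) (m : ℕ) {n : ℕ}
    (h : HasFactors σ τ n (π ^ m • A) A) : n ≤ m := by
  induction m generalizing n with
  | zero =>
    rw [pow_zero, one_smul] at h
    exact (h.eq_zero_of_self hτ).le
  | succ m ih =>
    have e : π ^ (m + 1) • A = π • (π ^ m • A) := by rw [pow_succ', mul_smul]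
    rw [e] at h
    obtain ⟨a, b, rfl, ha, hb⟩ := h.split_of_le hτ (hA.smul π)
      (submodule_smul_mono π (submodule_smul_le _ _)) (submodule_smul_le _ _)
    have ha' := ih ((hasFactors_smul_iff hπ).1 ha)
    have hb' : b < 2 := by
      by_contra hb'
      exact h2 (hb.of_le (not_lt.1 hb'))
    omega

/-- The multiplicity of a simple factor in `T / πT` does not increase when `T` is replaced by
a commensurable stable submodule. -/
theorem not_hasFactors_two_of_commensurable {π : R}
    (hπ : Function.Injective (LinearMap.lsmul R M π)) (hτ : IsSimpleAct τ)
    {A T : Submodule R M} (hA : ActStable σ A) (h2 : ¬ HasFactors σ τ 2 (π • A) A)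
    (hT : ActStable σ T) (hAT : PowCommensurable π A T) : ¬ HasFactors σ τ 2 (π • T) T := by
  intro h
  obtain ⟨m, hm⟩ := hAT.2
  have hX := commensurable_pow_smul π m T
  generalize hXT : π ^ m • T = X at hm hX
  have hXs : ActStable σ X := hXT ▸ hT.smul _
  have hX2 : HasFactors σ τ 2 (π • X) X := by
    rw [← hXT, smul_smul, mul_comm, ← smul_smul]
    exact (hasFactors_smul_iff (injective_lsmul_pow hπ m)).2 h
  obtain ⟨n, hn⟩ := (hAT.trans hX).1
  have hbound : ∀ d, HasFactors σ τ d X A → d ≤ n := fun d hd =>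
    hasFactors_le_of_pow hπ hτ hA h2 n (hd.mono_left hn)
  have hd := Nat.findGreatest_spec (P := fun d => HasFactors σ τ d X A) (Nat.zero_le n)
    (HasFactors.zero hm)
  obtain ⟨a, b, hab, ha, hb⟩ := (hX2.trans hd).split_of_le hτ (hA.smul π)
    (submodule_smul_mono π hm) (submodule_smul_le _ _)
  have ha' := (hasFactors_smul_iff hπ).1 ha
  have := Nat.le_findGreatest (P := fun d => HasFactors σ τ d X A) (hbound a ha') ha'
  exact h2 (hb.of_le (by omega))

/-- If a simple factor has multiplicity at most one in every reduction, then it cannot occur on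
both sides of `A ⊓ B`. -/
theorem not_hasFactors_of_hasFactors_inf {π : R}
    (hπτ : ∀ x : N, π • x = 0) {A B : Submodule R M}
    (hmult : ∀ T, ActStable σ T → A ⊓ B ≤ T → T ≤ A ⊔ B → ¬ HasFactors σ τ 2 (π • T) T)
    (hA : HasFactors σ τ 1 (A ⊓ B) A) : ¬ HasFactors σ τ 1 (A ⊓ B) B := by
  intro hB
  obtain ⟨A₁, A₂, hA₁, hAf, hA₂⟩ := hA.exists_isFactor
  obtain ⟨B₁, B₂, hB₁, hBf, hB₂⟩ := hB.exists_isFactor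
  have hinf : A₂ ⊓ B₂ ≤ A ⊓ B := inf_le_inf hA₂ hB₂
  have f1 : IsFactor σ τ (A₁ ⊔ B₁) (A₂ ⊔ B₁) :=
    hAf.sup hBf.left ((inf_le_inf_left _ hBf.le).trans (hinf.trans hA₁))
  have f2 : IsFactor σ τ (B₁ ⊔ A₂) (B₂ ⊔ A₂) :=
    hBf.sup hAf.right ((inf_comm _ _).le.trans (hinf.trans hB₁))
  rw [sup_comm B₁ A₂, sup_comm B₂ A₂] at f2
  refine hmult (A₂ ⊔ B₂) (hAf.right.sup hBf.right)
    (hA₁.trans (hAf.le.trans le_sup_left)) (sup_le_sup hA₂ hB₂) ?_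
  refine (f1.hasFactors.trans f2.hasFactors).mono_left ?_
  rw [Submodule.smul_sup']
  exact sup_le_sup (hAf.smul_le hπτ) (hBf.smul_le hπτ)

/-- `L₁ ≤ L₂ ≤ L₃` exhibits `L₃ / L₁` as a uniserial extension of `τ` by `υ`, killed by `π`. -/
structure IsUniserial (π : R) (σ : G → M →ₗ[R] M) (τ : G → N →ₗ[R] N) (υ : G → N' →ₗ[R] N')
    (L₁ L₂ L₃ : Submodule R M) : Prop where
  bottom : IsFactor σ υ L₁ L₂
  top : IsFactor σ τ L₂ L₃
  smul_le : π • L₃ ≤ L₁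
  eq : ∀ X, ActStable σ X → L₁ ≤ X → X ≤ L₃ → X = L₁ ∨ X = L₂ ∨ X = L₃

theorem IsUniserial.smul {π r : R} (hr : Function.Injective (LinearMap.lsmul R M r))
    {L₁ L₂ L₃ : Submodule R M} (h : IsUniserial π σ τ υ L₁ L₂ L₃) :
    IsUniserial π σ τ υ (r • L₁) (r • L₂) (r • L₃) := by
  refine ⟨h.bottom.map (lsmul_comm r) hr, h.top.map (lsmul_comm r) hr, ?_, fun X hX h1 h3 => ?_⟩
  · rw [smul_smul, mul_comm, ← smul_smul]
    exact submodule_smul_mono r h.smul_le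
  have hle : X ≤ LinearMap.range (LinearMap.lsmul R M r) := h3.trans LinearMap.map_le_range
  have h1' : L₁ ≤ X.comap (LinearMap.lsmul R M r) := Submodule.map_le_iff_le_comap.1 h1
  have h3' : X.comap (LinearMap.lsmul R M r) ≤ L₃ :=
    (Submodule.comap_mono h3).trans (Submodule.comap_map_eq_of_injective hr L₃).le
  rw [← Submodule.map_comap_eq_of_le hle]
  rcases h.eq _ (hX.comap (lsmul_comm r)) h1' h3' with e | e | e <;> rw [e]
  · exact Or.inl rfl
  · exact Or.inr (Or.inl rfl)
  · exact Or.inr (Or.inr rfl)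

theorem isUniserial_of_nonsplit {π : R} {L₁ L₂ L₃ : Submodule R M} (hτ : IsSimpleAct τ)
    (hυ : IsSimpleAct υ) (h12 : IsFactor σ υ L₁ L₂) (h23 : IsFactor σ τ L₂ L₃)
    (h13 : π • L₃ ≤ L₁)
    (hns : ¬ ∃ C : Submodule R M, ActStable σ C ∧ L₁ ≤ C ∧ C ≤ L₃ ∧ C ⊓ L₂ = L₁ ∧
      C ⊔ L₂ = L₃) : IsUniserial π σ τ υ L₁ L₂ L₃ := by
  refine ⟨h12, h23, h13, fun X hX h1 h3 => ?_⟩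
  rcases h12.eq_or_eq hυ (hX.inf h12.right) (le_inf h1 h12.le) inf_le_right with e | e
  · rcases h23.eq_or_eq hτ (hX.sup h12.right) le_sup_right (sup_le h3 h23.le) with e' | e'
    · left
      rwa [inf_eq_left.2 (sup_eq_right.1 e')] at e
    · exact absurd ⟨X, hX, h1, h3, e, e'⟩ hns
  · exact Or.inr (h23.eq_or_eq hτ hX (inf_eq_right.1 e) h3)

theorem IsUniserial.sup_eq {π : R} {L₁ L₂ L₃ X : Submodule R M} (h : IsUniserial π σ τ υ L₁ L₂ L₃)
    (hX : ActStable σ X) (hX3 : X ≤ L₃) (hXτ : ¬ HasFactors σ τ 1 X L₃) : X ⊔ L₁ = L₃ := by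
  have hX2 : ¬ X ≤ L₂ := fun hle => hXτ (h.top.hasFactors.mono_left hle)
  rcases h.eq _ (hX.sup h.bottom.left) le_sup_right
    (sup_le hX3 (h.bottom.le.trans h.top.le)) with e | e | e
  · exact absurd ((sup_eq_right.1 e).trans h.bottom.le) hX2
  · exact absurd (le_sup_left.trans e.le) hX2
  · exact e

theorem IsUniserial.inf_le_inf {π : R} (hυ : IsSimpleAct υ)
    {L₁ L₂ L₃ L₁' L₂' L₃' P : Submodule R M} (h : IsUniserial π σ τ υ L₁ L₂ L₃)
    (h' : IsUniserial π σ τ υ L₁' L₂' L₃') (hP : ActStable σ P) (hP' : P ≤ L₃')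
    (hPL : P ⊔ L₁ = L₃) (hmult : ¬ HasFactors σ υ 2 (π • P) P) : P ⊓ L₁ ≤ P ⊓ L₁' := by
  by_contra hne
  have hK : ActStable σ (P ⊓ L₁) := hP.inf h.bottom.left
  have hL₂ : L₂' ≤ (P ⊓ L₁) ⊔ L₁' := by
    rcases h'.eq _ (hK.sup h'.bottom.left) le_sup_right
      (sup_le (inf_le_left.trans hP') (h'.bottom.le.trans h'.top.le)) with e | e | e
    · exact absurd (le_inf inf_le_left (sup_eq_right.1 e)) hne
    · exact e.ge
    · exact h'.top.le.trans e.ge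
  have f1 : HasFactors σ υ 1 (P ⊓ L₁ ⊓ L₁') (P ⊓ L₁) :=
    (h'.bottom.hasFactors.mono_right hL₂).of_sup hυ hK
  have f2 : HasFactors σ υ 1 (P ⊓ L₁) P :=
    (h.bottom.hasFactors.mono_right (h.top.le.trans hPL.ge)).of_sup hυ hP
  refine hmult ((f1.trans f2).mono_left (le_inf (le_inf (submodule_smul_le _ _) ?_) ?_))
  · exact (submodule_smul_mono π (le_sup_left.trans hPL.le)).trans h.smul_le
  · exact (submodule_smul_mono π hP').trans h'.smul_le

/-- Among the multiples `π ^ n • B`, one can be chosen such that a simple factor of multiplicity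
one occurs on neither side of `A ⊓ π ^ n • B`. -/
theorem exists_pow_smul_not_hasFactors_inf {π : R} (hτ : IsSimpleAct τ)
    (hπτ : ∀ x : N, π • x = 0) {A B X : Submodule R M} (hA : ActStable σ A)
    (hB : ActStable σ B) (hAB : A ≤ B) (hX : IsFactor σ τ X A) (hBX : ∃ n : ℕ, π ^ n • B ≤ X)
    (hmult : ∀ T, ActStable σ T → PowCommensurable π A T → ¬ HasFactors σ τ 2 (π • T) T) :
    ∃ n : ℕ, ¬ HasFactors σ τ 1 (A ⊓ π ^ n • B) A ∧
      ¬ HasFactors σ τ 1 (A ⊓ π ^ n • B) (π ^ n • B) := by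
  have hex : ∃ n : ℕ, HasFactors σ τ 1 (A ⊓ π ^ n • B) A := by
    obtain ⟨n, hn⟩ := hBX
    exact ⟨n, hX.hasFactors.mono_left (inf_le_right.trans hn)⟩
  have hAcomm : PowCommensurable π A A := by simpa using commensurable_pow_smul π 0 A
  have hBcomm : PowCommensurable π A B :=
    ⟨exists_pow_smul_le_of_le hAB,
      exists_pow_smul_le_trans hBX (exists_pow_smul_le_of_le hX.le)⟩
  obtain ⟨n, hn, hmin⟩ : ∃ n : ℕ, HasFactors σ τ 1 (A ⊓ π ^ (n + 1) • B) A ∧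
      ¬ HasFactors σ τ 1 (A ⊓ π ^ n • B) A := by
    obtain ⟨n, hn⟩ : ∃ n, Nat.find hex = n + 1 := by
      refine Nat.exists_eq_succ_of_ne_zero fun h0 => ?_
      have := Nat.find_spec hex
      rw [h0, pow_zero, one_smul, inf_eq_left.2 hAB] at this
      exact one_ne_zero (this.eq_zero_of_self hτ)
    exact ⟨n, hn ▸ Nat.find_spec hex, Nat.find_min hex (by omega)⟩
  refine ⟨n, hmin, fun hcon => ?_⟩
  have hC := hB.smul (π ^ n)
  have hCcomm := hBcomm.trans (commensurable_pow_smul π n B)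
  have hDcomm := hBcomm.trans (commensurable_pow_smul π (n + 1) B)
  have e : π ^ (n + 1) • B = π • (π ^ n • B) := by rw [pow_succ', mul_smul]
  rw [e] at hn hDcomm
  generalize π ^ n • B = C at *
  have hD := hC.smul π
  have hCD : π • C ≤ C := submodule_smul_le _ _
  have hno : ¬ HasFactors σ τ 1 (A ⊓ π • C) (π • C) :=
    not_hasFactors_of_hasFactors_inf hπτ (fun T hT h1 h2 => hmult T hT
      ((hAcomm.inf hDcomm).of_le_of_le (hAcomm.sup hDcomm) h1 h2)) hn
  obtain ⟨a, b, hab, ha, hb⟩ := hn.split_of_le hτ (hA.inf hC) (inf_le_inf_left A hCD)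
    inf_le_left
  have hb0 : b = 0 := by
    by_contra hb0
    exact hmin (hb.of_le (by omega))
  obtain ⟨a', b', hab', ha', hb'⟩ := (ha.trans hcon).split_of_le hτ hD inf_le_right hCD
  have ha0 : a' = 0 := by
    by_contra ha0
    exact hno (ha'.of_le (by omega))
  exact hmult C hC hCcomm (hb'.of_le (by omega))

/-- Uniserial extensions of `τ` by `υ` inside commensurable stable submodules are isomorphic if
`τ` and `υ` have multiplicity at most one in every reduction. -/
theorem IsUniserial.subquotCorr {π : R} (hπ : Function.Injective (LinearMap.lsmul R M π))
    (hτ : IsSimpleAct τ) (hυ : IsSimpleAct υ) (hπτ : ∀ x : N, π • x = 0)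
    {L₁ L₂ L₃ L₁' L₂' L₃' : Submodule R M} (h : IsUniserial π σ τ υ L₁ L₂ L₃)
    (h' : IsUniserial π σ τ υ L₁' L₂' L₃') (hcomm : PowCommensurable π L₃ L₃')
    (hmτ : ∀ T, ActStable σ T → PowCommensurable π L₃ T → ¬ HasFactors σ τ 2 (π • T) T)
    (hmυ : ∀ T, ActStable σ T → PowCommensurable π L₃ T → ¬ HasFactors σ υ 2 (π • T) T) :
    SubquotCorr σ L₁ L₃ σ L₁' L₃' := by
  obtain ⟨a, ha⟩ := hcomm.1
  have hAcomm := commensurable_pow_smul π a L₃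
  have hAinj := injective_lsmul_pow hπ a
  have hA := h.smul hAinj
  obtain ⟨n, hn, hn'⟩ := exists_pow_smul_not_hasFactors_inf hτ hπτ hA.top.right h'.top.right
    ha hA.top (exists_pow_smul_le_trans (hcomm.symm.trans hAcomm).1
      ⟨1, by rw [pow_one]; exact hA.smul_le.trans hA.bottom.le⟩)
    (fun T hT hT' => hmτ T hT (hAcomm.trans hT'))
  have hBinj := injective_lsmul_pow hπ n
  have hB := h'.smul hBinj
  have hPcomm := hAcomm.inf (hcomm.trans (commensurable_pow_smul π n L₃'))
  have hP := hA.top.right.inf hB.top.right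
  have e := hA.sup_eq hP inf_le_left hn
  have e' := hB.sup_eq hP inf_le_right hn'
  have hK := le_antisymm (hA.inf_le_inf hυ hB hP inf_le_right e (hmυ _ hP hPcomm))
    (hB.inf_le_inf hυ hA hP inf_le_left e' (hmυ _ hP hPcomm))
  have c := subquotCorr_inf_sup hP hA.bottom.left
  have c' := subquotCorr_inf_sup hP hB.bottom.left
  rw [e, hK] at c
  rw [e'] at c'
  exact ((subquotCorr_map (lsmul_comm _) hAinj h.top.right).trans c.symm).trans
    (c'.trans (subquotCorr_map (lsmul_comm _) hBinj h'.top.right).symm)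

end Scaling

section LatticeLemmas

theorem injective_lsmul_of_ne_zero {O : Type*} [CommRing O] [IsDomain O] (K : Type*) [Field K]
    [Algebra O K] [IsFractionRing O K] {V : Type*} [AddCommGroup V] [Module K V] [Module O V]
    [IsScalarTower O K V] {r : O} (hr : r ≠ 0) : Function.Injective (LinearMap.lsmul O V r) := by
  intro x y h
  have h' : algebraMap O K r • x = algebraMap O K r • y := by
    rw [algebraMap_smul, algebraMap_smul]
    exact h
  refine smul_right_injective V ?_ h'
  rwa [Ne, IsFractionRing.to_map_eq_zero_iff]

variable {O : Type*} [CommRing O] [IsDomain O] [IsDiscreteValuationRing O]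
variable {K : Type*} [Field K] [Algebra O K] [IsFractionRing O K]
variable {V : Type*} [AddCommGroup V] [Module K V] [Module O V] [IsScalarTower O K V]

theorem exists_pow_smul_mem_of_mem_span {π : O} (hπ : Irreducible π) {T : Submodule O V} {x : V}
    (hx : x ∈ Submodule.span K (T : Set V)) : ∃ n : ℕ, π ^ n • x ∈ T := by
  induction hx using Submodule.span_induction with
  | mem x hx => exact ⟨0, by simpa using hx⟩
  | zero => exact ⟨0, by simp⟩
  | add x y _ _ hx hy =>
    obtain ⟨m, hm⟩ := hx
    obtain ⟨n, hn⟩ := hy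
    refine ⟨m + n, ?_⟩
    rw [smul_add]
    refine T.add_mem ?_ ?_
    · rw [pow_add, mul_comm, mul_smul]
      exact T.smul_mem _ hm
    · rw [pow_add, mul_smul]
      exact T.smul_mem _ hn
  | smul k x _ hx =>
    obtain ⟨n, hn⟩ := hx
    obtain ⟨a, b, hb, rfl⟩ := IsFractionRing.div_surjective (A := O) k
    have hb0 := nonZeroDivisors.ne_zero hb
    obtain ⟨m, u, hu⟩ := IsDiscreteValuationRing.eq_unit_mul_pow_irreducible hb0 hπ
    have hb1 : algebraMap O K b ≠ 0 := by
      rwa [Ne, IsFractionRing.to_map_eq_zero_iff]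
    have hba : b • ((algebraMap O K a / algebraMap O K b) • x) = a • x := by
      rw [← algebraMap_smul K b, smul_smul, mul_div_cancel₀ _ hb1, algebraMap_smul]
    have hm : π ^ m = (↑u⁻¹ : O) * b := by rw [hu, Units.inv_mul_cancel_left]
    refine ⟨n + m, ?_⟩
    rw [pow_add, mul_smul, hm, mul_smul, hba, smul_comm, smul_comm (π ^ n) a]
    exact T.smul_mem _ (T.smul_mem _ hn)

theorem exists_pow_smul_le_of_fg {π : O} (hπ : Irreducible π) {T T' : Submodule O V}
    (hT : T.FG) (hT' : Submodule.span K (T' : Set V) = ⊤) : ∃ n : ℕ, π ^ n • T ≤ T' := by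
  induction T, hT using Submodule.fg_induction with
  | singleton x =>
    obtain ⟨n, hn⟩ := exists_pow_smul_mem_of_mem_span (K := K) hπ
      (show x ∈ Submodule.span K (T' : Set V) from hT' ▸ trivial)
    refine ⟨n, ?_⟩
    rw [smul_eq_map_lsmul, Submodule.map_span_le]
    rintro _ rfl
    exact hn
  | sup A B _ _ hA hB =>
    obtain ⟨m, hm⟩ := hA
    obtain ⟨n, hn⟩ := hB
    refine ⟨m + n, ?_⟩
    rw [Submodule.smul_sup']
    refine sup_le ?_ ?_
    · rw [pow_add, mul_comm, mul_smul]
      exact (submodule_smul_le _ _).trans hm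
    · rw [pow_add, mul_smul]
      exact (submodule_smul_le _ _).trans hn

theorem IsLattice.commensurable {π : O} (hπ : Irreducible π) {T T' : Submodule O V}
    (hT : IsLattice K T) (hT' : IsLattice K T') : PowCommensurable π T T' :=
  ⟨exists_pow_smul_le_of_fg hπ hT.1 hT'.2, exists_pow_smul_le_of_fg hπ hT'.1 hT.2⟩

variable {G : Type*} [Group G]

theorem IsInvariantSub.actStable {ρ : Representation K G V} {T : Submodule O V}
    (h : IsInvariantSub ρ T) : ActStable (resAct ρ) T :=
  fun g x hx => (h g).le ⟨x, hx, rfl⟩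

theorem piSmul_le (π : O) (T : Submodule O V) : piSmul π T ≤ T :=
  submodule_smul_le π T

theorem ActStable.piSmul {σ : G → V →ₗ[O] V} {T : Submodule O V} (h : ActStable σ T) (π : O) :
    ActStable σ (piSmul π T) :=
  ActStable.smul h π

variable {W : Type*} [AddCommGroup W] [Module O W] {τ : G → W →ₗ[O] W}
variable {W' : Type*} [AddCommGroup W'] [Module O W'] {υ : G → W' →ₗ[O] W'}

theorem isFactor_liftSub_iff {ρ : Representation K G V} {π : O} {Λ : Submodule O V}
    (hΛ : ActStable (resAct ρ) Λ) {U₁ U₂ : Submodule O (SubQuot (piSmul π Λ) Λ)}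
    (h₁ : ActStable (redAct ρ π Λ) U₁) (h₂ : ActStable (redAct ρ π Λ) U₂) (hle : U₁ ≤ U₂) :
    IsFactor (resAct ρ) τ (liftSub U₁) (liftSub U₂) ↔
      IsRepIso (subQuotMap (redAct ρ π Λ) U₁ U₂) τ := by
  rw [isRepIso_iff_subquotCorr h₁ h₂]
  have c := subquotCorr_liftSub (hΛ.piSmul π) hΛ (U₁ := U₁) h₂
  exact ⟨fun h => c.symm.trans h.corr, fun h => ⟨liftSub_le_liftSub.2 hle,
    actStable_liftSub (hΛ.piSmul π) hΛ h₁, actStable_liftSub (hΛ.piSmul π) hΛ h₂, c.trans h⟩⟩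

theorem isIrredSubquot_liftSub {ρ : Representation K G V} {π : O} {Λ : Submodule O V}
    (hΛ : ActStable (resAct ρ) Λ) {U₁ U₂ : Submodule O (SubQuot (piSmul π Λ) Λ)}
    (h : IsIrredSubquot (redAct ρ π Λ) U₁ U₂) :
    IsIrredSubquot (resAct ρ) (liftSub U₁) (liftSub U₂) := by
  refine ⟨actStable_liftSub (hΛ.piSmul π) hΛ h.1, actStable_liftSub (hΛ.piSmul π) hΛ h.2.1,
    lt_of_le_not_ge (liftSub_le_liftSub.2 h.2.2.1.le) fun hle =>
      h.2.2.1.not_ge (liftSub_le_liftSub.1 hle), fun X hX h1 h2 => ?_⟩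
  obtain ⟨U, hU, rfl⟩ := exists_liftSub_eq (hΛ.piSmul π) hΛ hX
    ((le_liftSub (piSmul_le π Λ) _).trans h1) (h2.trans (liftSub_le _))
  rcases h.2.2.2 U hU (liftSub_le_liftSub.1 h1) (liftSub_le_liftSub.1 h2) with rfl | rfl
  · exact Or.inl rfl
  · exact Or.inr rfl

theorem isUniserial_liftSub {ρ : Representation K G V} {π : O} {Λ : Submodule O V}
    (hΛ : ActStable (resAct ρ) Λ) (hτ : IsSimpleAct τ) (hυ : IsSimpleAct υ)
    {U₁ U₂ U₃ : Submodule O (SubQuot (piSmul π Λ) Λ)}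
    (h₁ : ActStable (redAct ρ π Λ) U₁) (h₂ : ActStable (redAct ρ π Λ) U₂)
    (h₃ : ActStable (redAct ρ π Λ) U₃) (h12 : U₁ ≤ U₂) (h23 : U₂ ≤ U₃)
    (hυ' : IsRepIso (subQuotMap (redAct ρ π Λ) U₁ U₂) υ)
    (hτ' : IsRepIso (subQuotMap (redAct ρ π Λ) U₂ U₃) τ)
    (hns : ¬ ∃ C : Submodule O (SubQuot (piSmul π Λ) Λ),
        ActStable (redAct ρ π Λ) C ∧ U₁ ≤ C ∧ C ≤ U₃ ∧ C ⊓ U₂ = U₁ ∧ C ⊔ U₂ = U₃) :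
    IsUniserial π (resAct ρ) τ υ (liftSub U₁) (liftSub U₂) (liftSub U₃) := by
  refine isUniserial_of_nonsplit hτ hυ ((isFactor_liftSub_iff hΛ h₁ h₂ h12).2 hυ')
    ((isFactor_liftSub_iff hΛ h₂ h₃ h23).2 hτ')
    ((submodule_smul_mono π (liftSub_le _)).trans (le_liftSub (piSmul_le π Λ) _)) ?_
  rintro ⟨X, hX, h1, h3, hinf, hsup⟩
  obtain ⟨C, hC, rfl⟩ := exists_liftSub_eq (hΛ.piSmul π) hΛ hX
    ((le_liftSub (piSmul_le π Λ) _).trans h1) (h3.trans (liftSub_le _))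
  have h1' := liftSub_le_liftSub.1 h1
  have h3' := liftSub_le_liftSub.1 h3
  refine hns ⟨C, hC, h1', h3', le_antisymm ?_ (le_inf h1' h12), le_antisymm (sup_le h3' h23) ?_⟩
  · refine liftSub_le_liftSub.1 (le_trans (le_inf ?_ ?_) hinf.le)
    · exact liftSub_le_liftSub.2 inf_le_left
    · exact liftSub_le_liftSub.2 inf_le_right
  · refine liftSub_le_liftSub.1 (hsup.ge.trans (sup_le ?_ ?_))
    · exact liftSub_le_liftSub.2 le_sup_left
    · exact liftSub_le_liftSub.2 le_sup_right

/-- A simple module occurring exactly once in a composition series of `Λ/πΛ` has multiplicity at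
most one in `Λ/πΛ`. -/
theorem not_hasFactors_two_of_existsUnique {ρ : Representation K G V} {π : O}
    {Λ : Submodule O V} (hΛ : ActStable (resAct ρ) Λ) (hτ : IsSimpleAct τ) {c : ℕ}
    {s : Fin (c + 1) → Submodule O (SubQuot (piSmul π Λ) Λ)} (h0 : s 0 = ⊥)
    (hc : s (Fin.last c) = ⊤)
    (hstep : ∀ k : Fin c, IsIrredSubquot (redAct ρ π Λ) (s k.castSucc) (s k.succ))
    (hmult : ∃! k : Fin c, IsRepIso (subQuotMap (redAct ρ π Λ) (s k.castSucc) (s k.succ)) τ) :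
    ¬ HasFactors (resAct ρ) τ 2 (π • Λ) Λ := by
  have hiff (k : Fin c) := isFactor_liftSub_iff (τ := τ) hΛ (hstep k).1 (hstep k).2.1
    (hstep k).2.2.1.le
  have := not_hasFactors_two_of_chain hτ (fun k => liftSub (s k))
    (fun k => isIrredSubquot_liftSub hΛ (hstep k))
    fun k l hk hl => hmult.unique ((hiff k).1 hk) ((hiff l).1 hl)
  simp only [h0, hc, liftSub_top] at this
  rwa [liftSub_bot (piSmul_le π Λ)] at this

end LatticeLemmas

section Statement

variable {O : Type*} [CommRing O] [IsDomain O] [IsDiscreteValuationRing O]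
variable {K : Type*} [Field K] [Algebra O K] [IsFractionRing O K]
variable {G : Type*} [Group G]
variable {V : Type*} [AddCommGroup V] [Module K V] [Module O V] [IsScalarTower O K V]
variable [FiniteDimensional K V]

theorem statement_12 (π : O) (hπ : Irreducible π) (ρ : Representation K G V)
    (hirr : IsIrreducibleRep ρ) (Λ₀ : Submodule O V) (hlat₀ : IsLattice K Λ₀)
    (hinv₀ : IsInvariantSub ρ Λ₀)
    {Wi : Type*} [AddCommGroup Wi] [Module O Wi] (σi : Representation O G Wi)
    (htori : ∀ x : Wi, π • x = 0) (hsimplei : IsSimpleAct (ofRep σi))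
    {Wj : Type*} [AddCommGroup Wj] [Module O Wj] (σj : Representation O G Wj)
    (htorj : ∀ x : Wj, π • x = 0) (hsimplej : IsSimpleAct (ofRep σj))
    (c : ℕ) (s : Fin (c + 1) → Submodule O (SubQuot (piSmul π Λ₀) Λ₀))
    (h0 : s 0 = ⊥) (hc : s (Fin.last c) = ⊤)
    (hstep : ∀ k : Fin c, IsIrredSubquot (redAct ρ π Λ₀) (s k.castSucc) (s k.succ))
    (hmulti : ∃! k : Fin c,
      IsRepIso (subQuotMap (redAct ρ π Λ₀) (s k.castSucc) (s k.succ)) (ofRep σi))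
    (hmultj : ∃! k : Fin c,
      IsRepIso (subQuotMap (redAct ρ π Λ₀) (s k.castSucc) (s k.succ)) (ofRep σj))
    (Λ Λ' : Submodule O V) (hlat : IsLattice K Λ) (hinv : IsInvariantSub ρ Λ)
    (hlat' : IsLattice K Λ') (hinv' : IsInvariantSub ρ Λ')
    (V₁ V₂ V₃ : Submodule O (SubQuot (piSmul π Λ) Λ))
    (hs₁ : ActStable (redAct ρ π Λ) V₁) (hs₂ : ActStable (redAct ρ π Λ) V₂)
    (hs₃ : ActStable (redAct ρ π Λ) V₃) (h12 : V₁ ≤ V₂) (h23 : V₂ ≤ V₃)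
    (hisoj : IsRepIso (subQuotMap (redAct ρ π Λ) V₁ V₂) (ofRep σj))
    (hisoi : IsRepIso (subQuotMap (redAct ρ π Λ) V₂ V₃) (ofRep σi))
    (hns : ¬ ∃ C : Submodule O (SubQuot (piSmul π Λ) Λ),
        ActStable (redAct ρ π Λ) C ∧ V₁ ≤ C ∧ C ≤ V₃ ∧ C ⊓ V₂ = V₁ ∧ C ⊔ V₂ = V₃)
    (V₁' V₂' V₃' : Submodule O (SubQuot (piSmul π Λ') Λ'))
    (hs₁' : ActStable (redAct ρ π Λ') V₁') (hs₂' : ActStable (redAct ρ π Λ') V₂')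
    (hs₃' : ActStable (redAct ρ π Λ') V₃') (h12' : V₁' ≤ V₂') (h23' : V₂' ≤ V₃')
    (hisoj' : IsRepIso (subQuotMap (redAct ρ π Λ') V₁' V₂') (ofRep σj))
    (hisoi' : IsRepIso (subQuotMap (redAct ρ π Λ') V₂' V₃') (ofRep σi))
    (hns' : ¬ ∃ C : Submodule O (SubQuot (piSmul π Λ') Λ'),
        ActStable (redAct ρ π Λ') C ∧ V₁' ≤ C ∧ C ≤ V₃' ∧ C ⊓ V₂' = V₁' ∧ C ⊔ V₂' = V₃') :
    IsRepIso (subQuotMap (redAct ρ π Λ) V₁ V₃) (subQuotMap (redAct ρ π Λ') V₁' V₃') := by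
  have hπ' := injective_lsmul_of_ne_zero K (V := V) hπ.ne_zero
  have hA₀ := hinv₀.actStable
  have hA := hinv.actStable
  have hA' := hinv'.actStable
  have hU := isUniserial_liftSub hA hsimplei hsimplej hs₁ hs₂ hs₃ h12 h23 hisoj hisoi hns
  have hU' := isUniserial_liftSub hA' hsimplei hsimplej hs₁' hs₂' hs₃' h12' h23' hisoj' hisoi' hns'
  have hL₃ (T : Submodule O V) (hT : IsLattice K T)
      (U : Submodule O (SubQuot (piSmul π T) T)) : PowCommensurable π Λ₀ (liftSub U) := by
    refine (hlat₀.commensurable hπ hT).trans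
      (PowCommensurable.of_le_of_le (commensurable_pow_smul π 1 T) (commensurable_pow_smul π 0 T)
        ?_ ?_)
    · rw [pow_one]
      exact le_liftSub (piSmul_le π T) U
    · rw [pow_zero, one_smul]
      exact liftSub_le U
  have hc₃ := hL₃ Λ hlat V₃
  have hi := not_hasFactors_two_of_existsUnique hA₀ hsimplei h0 hc hstep hmulti
  have hj := not_hasFactors_two_of_existsUnique hA₀ hsimplej h0 hc hstep hmultj
  have hcorr := hU.subquotCorr hπ' hsimplei hsimplej htori hU'
    (hc₃.symm.trans (hL₃ Λ' hlat' V₃'))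
    (fun T hT hT' =>
      not_hasFactors_two_of_commensurable hπ' hsimplei hA₀ hi hT (hc₃.trans hT'))
    (fun T hT hT' =>
      not_hasFactors_two_of_commensurable hπ' hsimplej hA₀ hj hT (hc₃.trans hT'))
  exact (((subquotCorr_liftSub (hA.piSmul π) hA hs₃).symm.trans hcorr).trans
    (subquotCorr_liftSub (hA'.piSmul π) hA' hs₃')).isRepIso hs₁ hs₃ hs₁' hs₃'

end Statement
end
end

section
/- Let v ∈ V be nonzero and let Λ be an invariant lattice that is maximal with respect to v. If Λ = Λ₁ ∩ ... ∩ Λ_n is an intersection of finitely many invariant lattices Λ₁, ..., Λ_n, then Λ = Λ_i for some 1 ≤ i ≤ n. -/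
noncomputable section

attribute [local instance] Classical.propDecidable

open Pointwise

section Statement

variable {O : Type*} [CommRing O] [IsDomain O] [IsDiscreteValuationRing O]
variable {K : Type*} [Field K] [Algebra O K] [IsFractionRing O K]
variable {G : Type*} [Group G]
variable {V : Type*} [AddCommGroup V] [Module K V] [Module O V] [IsScalarTower O K V]
variable [FiniteDimensional K V]

theorem statement_19 (π : O) (hπ : Irreducible π) (ρ : Representation K G V)
    (v : V) (hv : v ≠ 0) (Λ : Submodule O V) (hmax : IsMaximalAt ρ π Λ v)
    (n : ℕ) (Λs : Fin n → Submodule O V)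
    (hlat : ∀ i, IsLattice K (Λs i) ∧ IsInvariantSub ρ (Λs i))
    (hint : Λ = ⨅ i, Λs i) :
    ∃ i, Λ = Λs i := by
  obtain ⟨-, -, ⟨hvΛ, hvπ⟩, hmax⟩ := hmax
  have hπK : algebraMap O K π ≠ 0 := by
    simpa using hπ.ne_zero
  have hw : π • ((algebraMap O K π)⁻¹ • v) = v := by
    rw [← algebraMap_smul K π, smul_inv_smul₀ hπK]
  have hwΛ : (algebraMap O K π)⁻¹ • v ∉ Λ := fun h => hvπ ⟨_, h, hw⟩
  rw [hint, Submodule.mem_iInf, not_forall] at hwΛ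
  obtain ⟨i, hi⟩ := hwΛ
  have hle : Λ ≤ Λs i := hint.trans_le (iInf_le Λs i)
  refine ⟨i, (hmax (Λs i) (hlat i).1 (hlat i).2 ⟨hle hvΛ, ?_⟩ hle).symm⟩
  rintro ⟨u, hu, huv⟩
  apply hi
  have huv' : algebraMap O K π • u = v := by
    rw [algebraMap_smul]
    exact huv
  rwa [← huv', inv_smul_smul₀ hπK]

end Statement
end
end
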